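/- Cartan decomposition for the non-symmetric reductive spherical pair (G_2(ℂ), SL(3,ℂ)) of rank-one type: for every g ∈ G_2(ℂ) there exist k ∈ G_2, θ ∈ ℝ, and h ∈ G_2(ℂ) with h e_1 = e_1 (i.e. h in the realization of SL(3,ℂ)) such that g = k t_θ h. That is, G_2(ℂ) = G_2 · A_1 · SL(3,ℂ) where A_1 = {t_θ : θ ∈ ℝ}. -/

import Mathlib

open Matrix

noncomputable section

/-- The standard basis of the complexified Cayley algebra `𝕆_ℂ = ℂ^8`. -/
def e (i : Fin 8) : Fin 8 → ℂ := Pi.single i 1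

/-- The oriented lines of the multiplication table of the Cayley algebra:
`(i, j, k)` in this list means `e_i e_j = e_k`. -/
def octLines : List (Fin 8 × Fin 8 × Fin 8) :=
  [(1,2,3),(2,3,1),(3,1,2),
   (1,4,5),(4,5,1),(5,1,4),
   (1,6,7),(6,7,1),(7,1,6),
   (2,5,7),(5,7,2),(7,2,5),
   (2,6,4),(6,4,2),(4,2,6),
   (3,5,6),(5,6,3),(6,3,5),
   (3,4,7),(4,7,3),(7,3,4)]

/-- Product of two basis elements of the complexified Cayley algebra. -/
def octBasisMul (i j : Fin 8) : Fin 8 → ℂ :=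
  if i = 0 then e j
  else if j = 0 then e i
  else if i = j then -(e 0)
  else
    match octLines.find? (fun t => t.1 == i && t.2.1 == j) with
    | some t => e t.2.2
    | none =>
      match octLines.find? (fun t => t.1 == j && t.2.1 == i) with
      | some t => -(e t.2.2)
      | none => 0

/-- The bilinear multiplication of the complexified Cayley algebra `𝕆_ℂ`. -/
def octMul (x y : Fin 8 → ℂ) : Fin 8 → ℂ :=
  ∑ i, ∑ j, (x i * y j) • octBasisMul i j

/-- The standard symmetric bilinear form on `ℂ^8`. -/
def bform (v w : Fin 8 → ℂ) : ℂ := ∑ i, v i * w i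

/-- `SO(8, ℂ)`. -/
def SO8 (g : Matrix (Fin 8) (Fin 8) ℂ) : Prop := gᵀ * g = 1 ∧ g.det = 1

/-- A matrix has real entries. -/
def realMat (g : Matrix (Fin 8) (Fin 8) ℂ) : Prop := ∀ i j, (g i j).im = 0

/-- The realization of `G₂(ℂ)` as automorphisms of `𝕆_ℂ`. -/
def inG2 (g : Matrix (Fin 8) (Fin 8) ℂ) : Prop :=
  SO8 g ∧ ∀ x y, g.mulVec (octMul x y) = octMul (g.mulVec x) (g.mulVec y)

/-- The compact real form `G₂`. -/
def inG2cpt (g : Matrix (Fin 8) (Fin 8) ℂ) : Prop := inG2 g ∧ realMat g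

/-- The realization `B₃(ℂ)` of `Spin(7, ℂ)`. -/
def inB3 (g : Matrix (Fin 8) (Fin 8) ℂ) : Prop :=
  SO8 g ∧ ∃ g₀, SO8 g₀ ∧ g₀.mulVec (e 0) = e 0 ∧
    ∀ x y, octMul (g₀.mulVec x) (g.mulVec y) = g.mulVec (octMul x y)

/-- The compact real form `Spin(7)`. -/
def inSpin7 (g : Matrix (Fin 8) (Fin 8) ℂ) : Prop :=
  SO8 g ∧ realMat g ∧ ∃ g₀, SO8 g₀ ∧ realMat g₀ ∧ g₀.mulVec (e 0) = e 0 ∧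
    ∀ x y, octMul (g₀.mulVec x) (g.mulVec y) = g.mulVec (octMul x y)

/-- The one-parameter group `t_θ` (abelian slice `A₁` for `(G₂(ℂ), SL(3,ℂ))`). -/
def tmat (θ : ℝ) : Matrix (Fin 8) (Fin 8) ℂ :=
  Matrix.of fun i j =>
    (![ e 0,
        (Real.cosh θ : ℂ) • e 1 + (Complex.I * (Real.sinh θ : ℂ)) • e 2,
        (-(Complex.I * (Real.sinh θ : ℂ))) • e 1 + (Real.cosh θ : ℂ) • e 2,
        e 3,
        (Real.cosh (θ/2) : ℂ) • e 4 + (-(Complex.I * (Real.sinh (θ/2) : ℂ))) • e 7,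
        (Real.cosh (θ/2) : ℂ) • e 5 + (-(Complex.I * (Real.sinh (θ/2) : ℂ))) • e 6,
        (Complex.I * (Real.sinh (θ/2) : ℂ)) • e 5 + (Real.cosh (θ/2) : ℂ) • e 6,
        (Complex.I * (Real.sinh (θ/2) : ℂ)) • e 4 + (Real.cosh (θ/2) : ℂ) • e 7 ] j) i

/-- The generator `τ₁` of the one-parameter group `A₁`, i.e. `exp (θ τ₁) = t_θ`. -/
def tau1 : Matrix (Fin 8) (Fin 8) ℂ :=
  Matrix.of fun i j =>
    (![ 0,
        Complex.I • e 2,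
        (-Complex.I) • e 1,
        0,
        (-(Complex.I/2)) • e 7,
        (-(Complex.I/2)) • e 6,
        (Complex.I/2) • e 5,
        (Complex.I/2) • e 4 ] j) i

/-- The one-parameter group `ã_θ` (abelian slice `Ã₀` for `(Spin(7,ℂ), G₂(ℂ))`). -/
def atil (θ : ℝ) : Matrix (Fin 8) (Fin 8) ℂ :=
  Matrix.of fun i j =>
    (![ (Real.cosh θ : ℂ) • e 0 + (Complex.I * (Real.sinh θ : ℂ)) • e 1,
        (-(Complex.I * (Real.sinh θ : ℂ))) • e 0 + (Real.cosh θ : ℂ) • e 1,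
        (Real.cosh (θ/3) : ℂ) • e 2 + (-(Complex.I * (Real.sinh (θ/3) : ℂ))) • e 3,
        (Complex.I * (Real.sinh (θ/3) : ℂ)) • e 2 + (Real.cosh (θ/3) : ℂ) • e 3,
        (Real.cosh (θ/3) : ℂ) • e 4 + (-(Complex.I * (Real.sinh (θ/3) : ℂ))) • e 5,
        (Complex.I * (Real.sinh (θ/3) : ℂ)) • e 4 + (Real.cosh (θ/3) : ℂ) • e 5,
        (Real.cosh (θ/3) : ℂ) • e 6 + (-(Complex.I * (Real.sinh (θ/3) : ℂ))) • e 7,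
        (Complex.I * (Real.sinh (θ/3) : ℂ)) • e 6 + (Real.cosh (θ/3) : ℂ) • e 7 ] j) i

/-- The generator `α̃₁` of the one-parameter group `Ã₀`, i.e. `exp (θ α̃₁) = ã_θ`. -/
def alphatil1 : Matrix (Fin 8) (Fin 8) ℂ :=
  Matrix.of fun i j =>
    (![ Complex.I • e 1,
        (-Complex.I) • e 0,
        (-(Complex.I/3)) • e 3,
        (Complex.I/3) • e 2,
        (-(Complex.I/3)) • e 5,
        (Complex.I/3) • e 4,
        (-(Complex.I/3)) • e 7,
        (Complex.I/3) • e 6 ] j) i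

/-- The one-parameter group `a_x` (abelian slice `A₀` for `(SO(7,ℂ), G₂(ℂ))`). -/
def amat (x : ℝ) : Matrix (Fin 8) (Fin 8) ℂ :=
  Matrix.of fun i j =>
    (![ e 0,
        e 1,
        (Real.cosh x : ℂ) • e 2 + (Complex.I * (Real.sinh x : ℂ)) • e 3,
        (-(Complex.I * (Real.sinh x : ℂ))) • e 2 + (Real.cosh x : ℂ) • e 3,
        (Real.cosh x : ℂ) • e 4 + (Complex.I * (Real.sinh x : ℂ)) • e 5,
        (-(Complex.I * (Real.sinh x : ℂ))) • e 4 + (Real.cosh x : ℂ) • e 5,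
        (Real.cosh x : ℂ) • e 6 + (Complex.I * (Real.sinh x : ℂ)) • e 7,
        (-(Complex.I * (Real.sinh x : ℂ))) • e 6 + (Real.cosh x : ℂ) • e 7 ] j) i

/-- The matrix `I₊₋ = diag(1, −1, 1, −1, 1, −1, 1, −1)`. -/
def Ipm : Matrix (Fin 8) (Fin 8) ℂ :=
  Matrix.diagonal ![1, -1, 1, -1, 1, -1, 1, -1]

/-- The anti-holomorphic involution `σ₀(g) = I₊₋ ḡ I₊₋`. -/
def sigma0 (g : Matrix (Fin 8) (Fin 8) ℂ) : Matrix (Fin 8) (Fin 8) ℂ :=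
  Ipm * g.map (starRingEnd ℂ) * Ipm

end

theorem octMul_eq (x y : Fin 8 → ℂ) : octMul x y =
    ![x 0 * y 0 - x 1 * y 1 - x 2 * y 2 - x 3 * y 3 - x 4 * y 4 - x 5 * y 5 - x 6 * y 6 - x 7 * y 7,
      x 0 * y 1 + x 1 * y 0 + (x 2 * y 3 - x 3 * y 2) + (x 4 * y 5 - x 5 * y 4) + (x 6 * y 7 - x 7 * y 6),
      x 0 * y 2 + x 2 * y 0 + (x 3 * y 1 - x 1 * y 3) + (x 5 * y 7 - x 7 * y 5) + (x 6 * y 4 - x 4 * y 6),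
      x 0 * y 3 + x 3 * y 0 + (x 1 * y 2 - x 2 * y 1) + (x 5 * y 6 - x 6 * y 5) + (x 4 * y 7 - x 7 * y 4),
      x 0 * y 4 + x 4 * y 0 + (x 5 * y 1 - x 1 * y 5) + (x 2 * y 6 - x 6 * y 2) + (x 7 * y 3 - x 3 * y 7),
      x 0 * y 5 + x 5 * y 0 + (x 1 * y 4 - x 4 * y 1) + (x 7 * y 2 - x 2 * y 7) + (x 6 * y 3 - x 3 * y 6),
      x 0 * y 6 + x 6 * y 0 + (x 7 * y 1 - x 1 * y 7) + (x 4 * y 2 - x 2 * y 4) + (x 3 * y 5 - x 5 * y 3),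
      x 0 * y 7 + x 7 * y 0 + (x 1 * y 6 - x 6 * y 1) + (x 2 * y 5 - x 5 * y 2) + (x 3 * y 4 - x 4 * y 3)] := by
  funext k
  simp only [octMul, Fin.sum_univ_eight, octBasisMul, octLines]
  fin_cases k <;> simp [e, List.find?] <;> ring

/-- The map rotating the coordinate planes `(i, j)` and `(k, l)` simultaneously, with
cosine `c` and sine `s`. -/
def rotatePlanes {R : Type*} [Ring R] (i j k l : Fin 8) (c s : R) (x : Fin 8 → R) : Fin 8 → R :=
  fun a =>
    if a = i then c * x i - s * x j
    else if a = j then s * x i + c * x j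
    else if a = k then c * x k - s * x l
    else if a = l then s * x k + c * x l
    else x a

/-- The matrix of `rotatePlanes`. -/
def planesRotation (i j k l : Fin 8) (c s : ℂ) : Matrix (Fin 8) (Fin 8) ℂ :=
  LinearMap.toMatrix'
    { toFun := rotatePlanes i j k l c s
      map_add' := fun x y => by
        funext a; simp only [rotatePlanes, Pi.add_apply]; split_ifs <;> ring
      map_smul' := fun r x => by
        funext a
        simp only [rotatePlanes, Pi.smul_apply, smul_eq_mul, RingHom.id_apply]
        split_ifs <;> ring }

theorem planesRotation_mulVec (i j k l : Fin 8) (c s : ℂ) (x : Fin 8 → ℂ) :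
    planesRotation i j k l c s *ᵥ x = rotatePlanes i j k l c s x := by
  simp [planesRotation, LinearMap.toMatrix'_mulVec]

theorem planesRotation_apply (i j k l : Fin 8) (c s : ℂ) (a b : Fin 8) :
    planesRotation i j k l c s a b = rotatePlanes i j k l c s (Pi.single b 1) a := by
  rw [← planesRotation_mulVec, Matrix.mulVec_single_one]; rfl

theorem rotatePlanes_ofReal (i j k l : Fin 8) (c s : ℝ) (x : Fin 8 → ℝ) :
    rotatePlanes i j k l (c : ℂ) (s : ℂ) (fun n => (x n : ℂ)) =
      fun n => ((rotatePlanes i j k l c s x n : ℝ) : ℂ) := by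
  funext a
  simp only [rotatePlanes]
  split_ifs <;> push_cast <;> rfl

theorem planesRotation_mul {i j k l : Fin 8} (hd : [i, j, k, l].Nodup) (c s c' s' : ℂ) :
    planesRotation i j k l c s * planesRotation i j k l c' s' =
      planesRotation i j k l (c * c' - s * s') (s * c' + c * s') := by
  simp only [List.nodup_cons, List.mem_cons, List.not_mem_nil, or_false, not_or] at hd
  obtain ⟨⟨h1, h2, h3⟩, ⟨h4, h5⟩, h6, -⟩ := hd
  refine Matrix.ext_of_mulVec_single fun b => ?_
  rw [← Matrix.mulVec_mulVec]
  simp only [planesRotation_mulVec]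
  funext a
  simp only [rotatePlanes, if_neg (Ne.symm h1), if_neg (Ne.symm h2), if_neg (Ne.symm h3),
    if_neg (Ne.symm h4), if_neg (Ne.symm h5), if_neg (Ne.symm h6), if_true]
  split_ifs <;> ring

theorem planesRotation_one_zero (i j k l : Fin 8) : planesRotation i j k l 1 0 = 1 := by
  refine Matrix.ext_of_mulVec_single fun b => ?_
  rw [planesRotation_mulVec, Matrix.one_mulVec]
  funext a
  simp only [rotatePlanes]
  split_ifs <;> simp_all

theorem planesRotation_transpose {i j k l : Fin 8} (hd : [i, j, k, l].Nodup) (c s : ℂ) :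
    (planesRotation i j k l c s)ᵀ = planesRotation i j k l c (-s) := by
  simp only [List.nodup_cons, List.mem_cons, List.not_mem_nil, or_false, not_or] at hd
  obtain ⟨⟨h1, h2, h3⟩, ⟨h4, h5⟩, h6, -⟩ := hd
  have h1' := Ne.symm h1
  have h2' := Ne.symm h2
  have h3' := Ne.symm h3
  have h4' := Ne.symm h4
  have h5' := Ne.symm h5
  have h6' := Ne.symm h6
  have cases_planes : ∀ a : Fin 8,
      a = i ∨ a = j ∨ a = k ∨ a = l ∨
        (a ≠ i ∧ i ≠ a) ∧ (a ≠ j ∧ j ≠ a) ∧ (a ≠ k ∧ k ≠ a) ∧ (a ≠ l ∧ l ≠ a) := by grind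
  ext a b
  rw [Matrix.transpose_apply, planesRotation_apply, planesRotation_apply]
  simp only [rotatePlanes, Pi.single_apply]
  rcases cases_planes a with rfl | rfl | rfl | rfl | ⟨⟨_, _⟩, ⟨_, _⟩, ⟨_, _⟩, _, _⟩ <;>
  rcases cases_planes b with rfl | rfl | rfl | rfl | ⟨⟨_, _⟩, ⟨_, _⟩, ⟨_, _⟩, _, _⟩ <;>
  first | (simp [*]; done) | simp [*, eq_comm]

theorem planesRotation_transpose_mul {i j k l : Fin 8} (hd : [i, j, k, l].Nodup) {c s : ℂ}
    (h : c ^ 2 + s ^ 2 = 1) :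
    (planesRotation i j k l c s)ᵀ * planesRotation i j k l c s = 1 := by
  rw [planesRotation_transpose hd, planesRotation_mul hd, ← planesRotation_one_zero i j k l]
  congr 1
  · linear_combination h
  · ring

theorem exists_half_angle {c s : ℂ} (h : c ^ 2 + s ^ 2 = 1) :
    ∃ c' s' : ℂ, c' ^ 2 + s' ^ 2 = 1 ∧ c' * c' - s' * s' = c ∧ s' * c' + c' * s' = s := by
  have hI := Complex.I_sq
  obtain ⟨u, hu⟩ := IsAlgClosed.exists_pow_nat_eq (c + Complex.I * s) two_pos
  have hzw : (c + Complex.I * s) * (c - Complex.I * s) = 1 := by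
    linear_combination h - s ^ 2 * hI
  have hu0 : u ≠ 0 := by
    rintro rfl
    rw [← hu] at hzw
    simp at hzw
  have hinv : u⁻¹ ^ 2 = c - Complex.I * s := by
    rw [inv_pow, hu]
    exact inv_eq_of_mul_eq_one_right hzw
  have huu : u * u⁻¹ = 1 := mul_inv_cancel₀ hu0
  refine ⟨(u + u⁻¹) / 2, -Complex.I * (u - u⁻¹) / 2, ?_, ?_, ?_⟩
  · linear_combination huu + (u - u⁻¹) ^ 2 / 4 * hI
  · linear_combination hu / 2 + hinv / 2 - (u - u⁻¹) ^ 2 / 4 * hI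
  · linear_combination -Complex.I * hu / 2 + Complex.I * hinv / 2 - s * hI

theorem planesRotation_SO8 {i j k l : Fin 8} (hd : [i, j, k, l].Nodup) {c s : ℂ}
    (h : c ^ 2 + s ^ 2 = 1) : SO8 (planesRotation i j k l c s) := by
  refine ⟨planesRotation_transpose_mul hd h, ?_⟩
  obtain ⟨c', s', h', rfl, rfl⟩ := exists_half_angle h
  rw [← planesRotation_mul hd, Matrix.det_mul]
  simpa using congrArg Matrix.det (planesRotation_transpose_mul hd h')

/-- The pairs of oriented coordinate planes whose simultaneous rotations are used to generate
enough automorphisms of the Cayley algebra. -/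
def automorphicPlanes : List (Fin 8 × Fin 8 × Fin 8 × Fin 8) :=
  [(2, 3, 5, 4), (2, 3, 7, 6), (4, 6, 5, 7), (2, 4, 3, 5), (1, 2, 7, 4), (1, 2, 6, 5)]

theorem automorphicPlanes_nodup {i j k l : Fin 8} (hm : (i, j, k, l) ∈ automorphicPlanes) :
    [i, j, k, l].Nodup := by
  simp only [automorphicPlanes, List.mem_cons, Prod.mk.injEq, List.not_mem_nil, or_false] at hm
  rcases hm with ⟨rfl, rfl, rfl, rfl⟩ | ⟨rfl, rfl, rfl, rfl⟩ | ⟨rfl, rfl, rfl, rfl⟩ |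
    ⟨rfl, rfl, rfl, rfl⟩ | ⟨rfl, rfl, rfl, rfl⟩ | ⟨rfl, rfl, rfl, rfl⟩ <;> decide

set_option maxHeartbeats 1600000 in
theorem rotatePlanes_octMul {i j k l : Fin 8} (hm : (i, j, k, l) ∈ automorphicPlanes) {c s : ℂ}
    (h : c ^ 2 + s ^ 2 = 1) (x y : Fin 8 → ℂ) :
    rotatePlanes i j k l c s (octMul x y) =
      octMul (rotatePlanes i j k l c s x) (rotatePlanes i j k l c s y) := by
  simp only [automorphicPlanes, List.mem_cons, Prod.mk.injEq, List.not_mem_nil, or_false] at hm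
  rcases hm with ⟨rfl, rfl, rfl, rfl⟩ | ⟨rfl, rfl, rfl, rfl⟩ | ⟨rfl, rfl, rfl, rfl⟩ |
    ⟨rfl, rfl, rfl, rfl⟩ | ⟨rfl, rfl, rfl, rfl⟩ | ⟨rfl, rfl, rfl, rfl⟩ <;>
  (funext a
   rw [octMul_eq, octMul_eq]
   fin_cases a <;> simp [rotatePlanes] <;> grind)

theorem planesRotation_inG2 {i j k l : Fin 8} (hm : (i, j, k, l) ∈ automorphicPlanes) {c s : ℂ}
    (h : c ^ 2 + s ^ 2 = 1) : inG2 (planesRotation i j k l c s) :=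
  ⟨planesRotation_SO8 (automorphicPlanes_nodup hm) h, fun x y => by
    simp only [planesRotation_mulVec, rotatePlanes_octMul hm h]⟩

theorem SO8.mul {g h : Matrix (Fin 8) (Fin 8) ℂ} (hg : SO8 g) (hh : SO8 h) : SO8 (g * h) := by
  refine ⟨?_, by rw [Matrix.det_mul, hg.2, hh.2, one_mul]⟩
  rw [Matrix.transpose_mul, Matrix.mul_assoc, ← Matrix.mul_assoc gᵀ, hg.1, Matrix.one_mul, hh.1]

theorem SO8.mul_transpose {g : Matrix (Fin 8) (Fin 8) ℂ} (hg : SO8 g) : g * gᵀ = 1 :=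
  mul_eq_one_comm.mp hg.1

theorem inG2.mul {g h : Matrix (Fin 8) (Fin 8) ℂ} (hg : inG2 g) (hh : inG2 h) : inG2 (g * h) :=
  ⟨hg.1.mul hh.1, fun x y => by simp only [← Matrix.mulVec_mulVec, hh.2, hg.2]⟩

theorem inG2.transpose {g : Matrix (Fin 8) (Fin 8) ℂ} (hg : inG2 g) : inG2 gᵀ := by
  refine ⟨⟨?_, by rw [Matrix.det_transpose, hg.1.2]⟩, fun x y => ?_⟩
  · rw [Matrix.transpose_transpose, hg.1.mul_transpose]
  · have h := hg.2 (gᵀ *ᵥ x) (gᵀ *ᵥ y)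
    simp only [Matrix.mulVec_mulVec, hg.1.mul_transpose, Matrix.one_mulVec] at h
    rw [← h, Matrix.mulVec_mulVec, hg.1.1, Matrix.one_mulVec]

theorem inG2cpt.mul {g h : Matrix (Fin 8) (Fin 8) ℂ} (hg : inG2cpt g) (hh : inG2cpt h) :
    inG2cpt (g * h) := by
  refine ⟨hg.1.mul hh.1, fun i j => ?_⟩
  simp [Matrix.mul_apply, Complex.mul_im, hg.2 _ _, hh.2 _ _]

theorem inG2cpt.transpose {g : Matrix (Fin 8) (Fin 8) ℂ} (hg : inG2cpt g) : inG2cpt gᵀ :=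
  ⟨hg.1.transpose, fun i j => hg.2 j i⟩

theorem realMat.mulVec_ofReal {k : Matrix (Fin 8) (Fin 8) ℂ} (hk : realMat k) (b : Fin 8 → ℝ) :
    ∃ b' : Fin 8 → ℝ, k *ᵥ (fun n => (b n : ℂ)) = fun n => (b' n : ℂ) := by
  refine ⟨fun n => ∑ m, (k n m).re * b m, funext fun n => ?_⟩
  simp only [Matrix.mulVec, dotProduct]
  push_cast
  refine Finset.sum_congr rfl fun m _ => ?_
  congr 1
  apply Complex.ext <;> simp [hk n m]

theorem octMul_e_zero (x : Fin 8 → ℂ) : octMul x (e 0) = x := by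
  rw [octMul_eq]
  funext k
  fin_cases k <;> simp [e]

theorem e_zero_octMul (x : Fin 8 → ℂ) : octMul (e 0) x = x := by
  rw [octMul_eq]
  funext k
  fin_cases k <;> simp [e]

theorem inG2.mulVec_e_zero {g : Matrix (Fin 8) (Fin 8) ℂ} (hg : inG2 g) : g *ᵥ e 0 = e 0 := by
  have h := hg.2 (e 0) (gᵀ *ᵥ e 0)
  rw [e_zero_octMul, Matrix.mulVec_mulVec, hg.1.mul_transpose, Matrix.one_mulVec,
    octMul_e_zero] at h
  exact h.symm

theorem SO8.mulVec_dotProduct {g : Matrix (Fin 8) (Fin 8) ℂ} (hg : SO8 g) (x y : Fin 8 → ℂ) :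
    (g *ᵥ x) ⬝ᵥ (g *ᵥ y) = x ⬝ᵥ y := by
  rw [Matrix.dotProduct_mulVec, Matrix.vecMul_mulVec, hg.1, Matrix.vecMul_one]

theorem inG2.mulVec_e_one_apply_zero {g : Matrix (Fin 8) (Fin 8) ℂ} (hg : inG2 g) :
    (g *ᵥ e 1) 0 = 0 := by
  have h := hg.1.mulVec_dotProduct (e 1) (e 0)
  rw [hg.mulVec_e_zero] at h
  simpa [e] using h

theorem inG2.sum_sq_mulVec_e_one {g : Matrix (Fin 8) (Fin 8) ℂ} (hg : inG2 g) :
    ∑ n, (g *ᵥ e 1) n ^ 2 = 1 := by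
  have h := hg.1.mulVec_dotProduct (e 1) (e 1)
  simp only [sq]
  rw [dotProduct, show e 1 ⬝ᵥ e 1 = 1 by simp [e]] at h
  simpa only [sq] using h

theorem planesRotation_inG2cpt {i j k l : Fin 8} (hm : (i, j, k, l) ∈ automorphicPlanes)
    {c s : ℝ} (h : c ^ 2 + s ^ 2 = 1) : inG2cpt (planesRotation i j k l c s) := by
  refine ⟨planesRotation_inG2 hm (by exact_mod_cast h), fun a b => ?_⟩
  have hb : (Pi.single b 1 : Fin 8 → ℂ) = fun n => ((Pi.single b 1 : Fin 8 → ℝ) n : ℂ) := by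
    funext n
    by_cases hn : n = b <;> simp [hn]
  rw [planesRotation_apply, hb, rotatePlanes_ofReal]
  exact Complex.ofReal_im _

theorem exists_rotation_eq_zero (p q : ℝ) :
    ∃ c s : ℝ, c ^ 2 + s ^ 2 = 1 ∧ 0 ≤ c * p - s * q ∧ s * p + c * q = 0 := by
  by_cases h : p ^ 2 + q ^ 2 = 0
  · have hp : p = 0 := by nlinarith [sq_nonneg p, sq_nonneg q]
    have hq : q = 0 := by nlinarith [sq_nonneg p, sq_nonneg q]
    exact ⟨1, 0, by simp, by simp [hp], by simp [hq]⟩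
  · have hpos : 0 < p ^ 2 + q ^ 2 := lt_of_le_of_ne (by positivity) (Ne.symm h)
    set r := √(p ^ 2 + q ^ 2) with hr
    have hr0 : 0 < r := Real.sqrt_pos.mpr hpos
    have hr2 : r ^ 2 = p ^ 2 + q ^ 2 := Real.sq_sqrt hpos.le
    refine ⟨p / r, -q / r, ?_, ?_, ?_⟩
    · field_simp
      linarith
    · have : p / r * p - -q / r * q = (p ^ 2 + q ^ 2) / r := by ring
      rw [this]
      positivity
    · ring

/-- `b` is the image of `a` under a compact automorphism fixing `e 1`. -/
def StabilizerReach (a b : Fin 8 → ℝ) : Prop :=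
  ∃ k, inG2cpt k ∧ k *ᵥ e 1 = e 1 ∧ k *ᵥ (fun n => (a n : ℂ)) = fun n => (b n : ℂ)

theorem StabilizerReach.trans {a b c : Fin 8 → ℝ} (hab : StabilizerReach a b)
    (hbc : StabilizerReach b c) : StabilizerReach a c := by
  obtain ⟨k, hk, hk1, hka⟩ := hab
  obtain ⟨k', hk', hk1', hkb⟩ := hbc
  refine ⟨k' * k, hk'.mul hk, ?_, ?_⟩
  · rw [← Matrix.mulVec_mulVec, hk1, hk1']
  · rw [← Matrix.mulVec_mulVec, hka, hkb]

theorem stabilizerReach_rotatePlanes {i j k l : Fin 8} (hm : (i, j, k, l) ∈ automorphicPlanes)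
    (h1 : (1 : Fin 8) ∉ [i, j, k, l]) {c s : ℝ} (h : c ^ 2 + s ^ 2 = 1) (a : Fin 8 → ℝ) :
    StabilizerReach a (rotatePlanes i j k l c s a) := by
  simp only [List.mem_cons, List.not_mem_nil, or_false, not_or] at h1
  obtain ⟨hi, hj, hk, hl⟩ := h1
  refine ⟨planesRotation i j k l c s, planesRotation_inG2cpt hm h, ?_, ?_⟩
  · rw [planesRotation_mulVec]
    funext n
    simp only [rotatePlanes, e, Pi.single_apply]
    split_ifs <;> simp_all
  · rw [planesRotation_mulVec, rotatePlanes_ofReal]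

theorem exists_stabilizerReach (a : Fin 8 → ℝ) :
    ∃ r : ℝ, StabilizerReach a ![a 0, a 1, r, 0, 0, 0, 0, 0] := by
  obtain ⟨b, hb, hb0, hb1, hb5⟩ : ∃ b, StabilizerReach a b ∧ b 0 = a 0 ∧ b 1 = a 1 ∧ b 5 = 0 := by
    obtain ⟨c, s, h, -, hz⟩ := exists_rotation_eq_zero (a 4) (-a 5)
    refine ⟨_, stabilizerReach_rotatePlanes (i := 2) (j := 3) (k := 5) (l := 4)
      (by simp [automorphicPlanes]) (by decide) h a, ?_, ?_, ?_⟩ <;>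
    simp [rotatePlanes]
    linarith
  obtain ⟨b', hb', hb0', hb1', hb5', hb7'⟩ :
      ∃ b', StabilizerReach b b' ∧ b' 0 = a 0 ∧ b' 1 = a 1 ∧ b' 5 = 0 ∧ b' 7 = 0 := by
    obtain ⟨c, s, h, -, hz⟩ := exists_rotation_eq_zero (b 6) (-b 7)
    refine ⟨_, stabilizerReach_rotatePlanes (i := 2) (j := 3) (k := 7) (l := 6)
      (by simp [automorphicPlanes]) (by decide) h b, ?_, ?_, ?_, ?_⟩ <;>
    simp [rotatePlanes, hb0, hb1, hb5]
    linarith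
  obtain ⟨d, hd, hd0, hd1, hd5, hd6, hd7⟩ :
      ∃ d, StabilizerReach b' d ∧ d 0 = a 0 ∧ d 1 = a 1 ∧ d 5 = 0 ∧ d 6 = 0 ∧ d 7 = 0 := by
    obtain ⟨c, s, h, -, hz⟩ := exists_rotation_eq_zero (b' 4) (b' 6)
    exact ⟨_, stabilizerReach_rotatePlanes (i := 4) (j := 6) (k := 5) (l := 7)
      (by simp [automorphicPlanes]) (by decide) h b', by simp [rotatePlanes, hb0'],
      by simp [rotatePlanes, hb1'], by simp [rotatePlanes, hb5', hb7'],
      by simpa [rotatePlanes] using hz, by simp [rotatePlanes, hb5', hb7']⟩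
  obtain ⟨d', hd', hd0', hd1', hd3', hd5', hd6', hd7'⟩ : ∃ d', StabilizerReach d d' ∧
      d' 0 = a 0 ∧ d' 1 = a 1 ∧ d' 3 = 0 ∧ d' 5 = 0 ∧ d' 6 = 0 ∧ d' 7 = 0 := by
    obtain ⟨c, s, h, -, hz⟩ := exists_rotation_eq_zero (d 2) (d 3)
    exact ⟨_, stabilizerReach_rotatePlanes (i := 2) (j := 3) (k := 7) (l := 6)
      (by simp [automorphicPlanes]) (by decide) h d, by simp [rotatePlanes, hd0],
      by simp [rotatePlanes, hd1], by simpa [rotatePlanes] using hz,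
      by simp [rotatePlanes, hd5], by simp [rotatePlanes, hd6, hd7],
      by simp [rotatePlanes, hd6, hd7]⟩
  obtain ⟨c, s, h, -, hz⟩ := exists_rotation_eq_zero (d' 2) (d' 4)
  have hlast := stabilizerReach_rotatePlanes (i := 2) (j := 4) (k := 3) (l := 5)
    (by simp [automorphicPlanes]) (by decide) h d'
  refine ⟨c * d' 2 - s * d' 4, ?_⟩
  convert (((hb.trans hb').trans hd).trans hd').trans hlast using 1
  funext n
  fin_cases n <;> simp [rotatePlanes, *]

theorem exists_compact_mulVec_eq (a : Fin 8 → ℝ) : ∃ (k : Matrix (Fin 8) (Fin 8) ℂ) (p : ℝ),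
    inG2cpt k ∧ 0 ≤ p ∧
      k *ᵥ (fun n => (a n : ℂ)) = fun n => ((![a 0, p, 0, 0, 0, 0, 0, 0] n : ℝ) : ℂ) := by
  obtain ⟨r, k, hk, -, hka⟩ := exists_stabilizerReach a
  obtain ⟨c, s, h, hp, hz⟩ := exists_rotation_eq_zero (a 1) r
  refine ⟨planesRotation 1 2 7 4 c s * k, c * a 1 - s * r,
    (planesRotation_inG2cpt (by simp [automorphicPlanes]) h).mul hk, hp, ?_⟩
  rw [← Matrix.mulVec_mulVec, hka, planesRotation_mulVec, rotatePlanes_ofReal]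
  funext n
  congr 1
  fin_cases n <;> simp [rotatePlanes, hz]

theorem tmat_eq_planesRotation_mul (θ : ℝ) :
    tmat θ =
      planesRotation 1 2 7 4 (Real.cosh (θ / 2)) (Complex.I * Real.sinh (θ / 2)) *
        planesRotation 1 2 6 5 (Real.cosh (θ / 2)) (Complex.I * Real.sinh (θ / 2)) := by
  have hI := Complex.I_sq
  have hc : (Real.cosh θ : ℂ) = (Real.cosh (θ / 2) : ℂ) ^ 2 + (Real.sinh (θ / 2) : ℂ) ^ 2 := by
    rw [← mul_div_cancel₀ θ (two_ne_zero' ℝ), Real.cosh_two_mul]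
    simp
  have hs : (Real.sinh θ : ℂ) = 2 * (Real.sinh (θ / 2) : ℂ) * (Real.cosh (θ / 2) : ℂ) := by
    rw [← mul_div_cancel₀ θ (two_ne_zero' ℝ), Real.sinh_two_mul]
    simp
  refine Matrix.ext_of_mulVec_single fun b => ?_
  rw [← Matrix.mulVec_mulVec, planesRotation_mulVec, planesRotation_mulVec,
    Matrix.mulVec_single_one]
  funext a
  simp only [tmat, Matrix.col_apply, Matrix.of_apply, hc, hs]
  generalize (Real.cosh (θ / 2) : ℂ) = c
  generalize (Real.sinh (θ / 2) : ℂ) = s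
  fin_cases b <;> fin_cases a <;> simp [e, rotatePlanes] <;> grind

theorem tmat_inG2 (θ : ℝ) : inG2 (tmat θ) := by
  have h : (Real.cosh (θ / 2) : ℂ) ^ 2 + (Complex.I * Real.sinh (θ / 2)) ^ 2 = 1 := by
    have := congrArg (fun x : ℝ => (x : ℂ)) (Real.cosh_sq_sub_sinh_sq (θ / 2))
    simp only [Complex.ofReal_sub, Complex.ofReal_pow, Complex.ofReal_one] at this
    rw [mul_pow, Complex.I_sq]
    linear_combination this
  rw [tmat_eq_planesRotation_mul]
  exact (planesRotation_inG2 (by simp [automorphicPlanes]) h).mul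
    (planesRotation_inG2 (by simp [automorphicPlanes]) h)

theorem tmat_mulVec_e_one (θ : ℝ) :
    tmat θ *ᵥ e 1 = (Real.cosh θ : ℂ) • e 1 + (Complex.I * (Real.sinh θ : ℂ)) • e 2 := by
  rw [e, Matrix.mulVec_single_one]
  rfl

theorem exists_compact_mul_mulVec_e_one {g : Matrix (Fin 8) (Fin 8) ℂ} (hg : inG2 g) :
    ∃ (k : Matrix (Fin 8) (Fin 8) ℂ) (θ : ℝ), inG2cpt k ∧ (k * g) *ᵥ e 1 = tmat θ *ᵥ e 1 := by
  obtain ⟨k, p, hk, hp, hkp⟩ := exists_compact_mulVec_eq fun n => ((g *ᵥ e 1) n).re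
  obtain ⟨b, hb⟩ := hk.2.mulVec_ofReal fun n => ((g *ᵥ e 1) n).im
  have hg0 := hg.mulVec_e_one_apply_zero
  have hkg : (k * g) *ᵥ e 1 = fun n =>
      ((![0, p, 0, 0, 0, 0, 0, 0] n : ℝ) : ℂ) + Complex.I * (b n : ℂ) := by
    have hsplit : g *ᵥ e 1 = (fun n => (((g *ᵥ e 1) n).re : ℂ)) +
        Complex.I • fun n => (((g *ᵥ e 1) n).im : ℂ) := by
      funext n
      simp [mul_comm Complex.I, Complex.re_add_im]
    rw [← Matrix.mulVec_mulVec, hsplit, Matrix.mulVec_add, Matrix.mulVec_smul, hkp, hb, hg0]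
    rfl
  have hb0 : b 0 = 0 := by
    have h := (hk.1.mul hg).mulVec_e_one_apply_zero
    rw [hkg] at h
    simpa using h
  have hnorm := (hk.1.mul hg).sum_sq_mulVec_e_one
  simp only [hkg, Fin.sum_univ_eight] at hnorm
  have hre := congrArg Complex.re hnorm
  have him := congrArg Complex.im hnorm
  simp [sq, hb0] at hre him
  have hb1 : b 1 = 0 := by
    have hp0 : p ≠ 0 := by
      rintro rfl
      nlinarith [mul_self_nonneg (b 1), mul_self_nonneg (b 2), mul_self_nonneg (b 3),
        mul_self_nonneg (b 4), mul_self_nonneg (b 5), mul_self_nonneg (b 6),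
        mul_self_nonneg (b 7)]
    have : p * b 1 = 0 := by linarith
    exact (mul_eq_zero.mp this).resolve_left hp0
  obtain ⟨r, k', hk', hk1', hkb'⟩ := exists_stabilizerReach b
  have hkg' : (k' * k * g) *ᵥ e 1 = (p : ℂ) • e 1 + (Complex.I * (r : ℂ)) • e 2 := by
    have hsplit : (k * g) *ᵥ e 1 = (p : ℂ) • e 1 + Complex.I • fun n => (b n : ℂ) := by
      rw [hkg]
      funext n
      fin_cases n <;> simp [e]
    rw [Matrix.mul_assoc, ← Matrix.mulVec_mulVec, hsplit, Matrix.mulVec_add, Matrix.mulVec_smul,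
      Matrix.mulVec_smul, hk1', hkb', hb0, hb1]
    funext n
    fin_cases n <;> simp [e]
  have hpr : p = √(1 + r ^ 2) := by
    have h := ((hk'.1.mul hk.1).mul hg).sum_sq_mulVec_e_one
    simp only [hkg', Fin.sum_univ_eight] at h
    simp [e, mul_pow] at h
    have h' : p ^ 2 + -r ^ 2 = 1 := by exact_mod_cast h
    rw [eq_comm, Real.sqrt_eq_iff_mul_self_eq (by positivity) hp]
    linarith
  refine ⟨k' * k, Real.arsinh r, hk'.mul hk, ?_⟩
  rw [hkg', tmat_mulVec_e_one, Real.sinh_arsinh, Real.cosh_arsinh, ← hpr]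

/-- **Theorem `thm:cartan-g2` (Cartan decomposition for Type R-2).**
For the non-symmetric reductive spherical pair `(G₂(ℂ), SL(3,ℂ))` of rank-one type:
every `g ∈ G₂(ℂ)` can be written `g = k t_θ h` with `k ∈ G₂` (the compact real form),
`θ ∈ ℝ`, and `h ∈ G₂(ℂ)` satisfying `h e₁ = e₁` (i.e. `h` in the realization of
`SL(3,ℂ)`).  That is, `G₂(ℂ) = G₂ · A₁ · SL(3,ℂ)`. -/
theorem stmt8 (g : Matrix (Fin 8) (Fin 8) ℂ) (hg : inG2 g) :
    ∃ (k : Matrix (Fin 8) (Fin 8) ℂ) (θ : ℝ) (h : Matrix (Fin 8) (Fin 8) ℂ),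
      inG2cpt k ∧ inG2 h ∧ h.mulVec (e 1) = e 1 ∧ g = k * tmat θ * h := by
  obtain ⟨k, θ, hk, hkg⟩ := exists_compact_mul_mulVec_e_one hg
  have ht := tmat_inG2 θ
  refine ⟨kᵀ, θ, (tmat θ)ᵀ * (k * g), hk.transpose, ht.transpose.mul (hk.1.mul hg), ?_, ?_⟩
  · rw [← Matrix.mulVec_mulVec, hkg, Matrix.mulVec_mulVec, ht.1.1, Matrix.one_mulVec]
  · rw [Matrix.mul_assoc, ← Matrix.mul_assoc (tmat θ), ht.1.mul_transpose, Matrix.one_mul,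
      ← Matrix.mul_assoc, hk.1.1.1, Matrix.one_mul]
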